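/- arXiv:2112.13892 — 3 statements merged into one kernel-verified Lean document; each statement's English description precedes it below -/
import Mathlib

section
/- Let (d; m_1, m_2, m_3, m_4) be a 4-point monodromy datum. Then the sum over e = 1, …, d−1 of the degrees F(e) of the Hurwitz–Hodge classes λ_1^e, given purely arithmetically by F(e) = α_e/d if σ_e = 2 and α_e + φ_e ≤ 1, F(e) = (1 − φ_e)/d if σ_e = 2 and α_e + φ_e > 1, and F(e) = 0 otherwise, equals (1/(24 d²)) · Σ_{I ⊆ {1,2,3,4}} (−1)^{|I|} · gcd(Σ_{i∈I} m_i, d)². (This is the arithmetic identity obtained by combining Theorem 1.1, Theorem 1.2 and the decomposition λ_1 = Σ_{e=1}^{d−1} λ_1^e.) -/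
open Finset

/-- The age `⟨e mᵢ / d⟩`: the fractional part of `e mᵢ / d`. -/
noncomputable def age (d e mi : ℤ) : ℚ := Int.fract ((e * mi : ℚ) / (d : ℚ))

/-- The sum of ages `σ_e`. -/
noncomputable def sigmaE (d e : ℤ) (m : Fin 4 → ℤ) : ℚ := ∑ i, age d e (m i)

/-- The smallest age `α_e`. -/
noncomputable def alphaE (d e : ℤ) (m : Fin 4 → ℤ) : ℚ :=
  min (min (age d e (m 0)) (age d e (m 1))) (min (age d e (m 2)) (age d e (m 3)))

/-- The largest age `φ_e`. -/
noncomputable def phiE (d e : ℤ) (m : Fin 4 → ℤ) : ℚ :=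
  max (max (age d e (m 0)) (age d e (m 1))) (max (age d e (m 2)) (age d e (m 3)))

/-- The arithmetic formula `F(e)` for the degree of the Hurwitz-Hodge class `λ₁ᵉ`. -/
noncomputable def F (d e : ℤ) (m : Fin 4 → ℤ) : ℚ :=
  if sigmaE d e m = 2 then
    if alphaE d e m + phiE d e m ≤ 1 then alphaE d e m / (d : ℚ)
    else (1 - phiE d e m) / (d : ℚ)
  else 0

/-- The function `{x}² - {x}`, the second periodic Bernoulli function up to a constant. -/
def fractQuad (x : ℚ) : ℚ := Int.fract x ^ 2 - Int.fract x

lemma fractQuad_add_intCast (x : ℚ) (n : ℤ) : fractQuad (x + n) = fractQuad x := by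
  simp [fractQuad]

lemma fractQuad_neg (x : ℚ) : fractQuad (-x) = fractQuad x := by
  unfold fractQuad
  by_cases h : Int.fract x = 0
  · rw [Int.fract_neg_eq_zero.mpr h, h]
  · rw [Int.fract_neg h]; ring

lemma fractQuad_of_mem_Ico {x : ℚ} (h0 : 0 ≤ x) (h1 : x < 1) : fractQuad x = x ^ 2 - x := by
  rw [fractQuad, Int.fract_eq_self.mpr ⟨h0, h1⟩]

lemma fractQuad_of_one_le {x : ℚ} (h0 : 1 ≤ x) (h1 : x < 2) :
    fractQuad x = (x - 1) ^ 2 - (x - 1) := by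
  rw [← fractQuad_of_mem_Ico (by linarith) (by linarith), ← fractQuad_add_intCast (x - 1) 1]
  simp

lemma fractQuad_eq_of_add_eq {x y : ℚ} {n : ℤ} (h : x + y = n) : fractQuad x = fractQuad y := by
  rw [← fractQuad_neg y, ← fractQuad_add_intCast (-y) n, ← h]
  congr 1
  ring

lemma sum_range_mul_of_periodic (h : ℕ → ℚ) (n : ℕ) (hp : ∀ e, h (e + n) = h e) (g : ℕ) :
    ∑ e ∈ range (g * n), h e = g * ∑ e ∈ range n, h e := by
  have hp' : ∀ g e, h (g * n + e) = h e := by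
    intro g
    induction g with
    | zero => simp
    | succ g ih =>
      intro e
      rw [← ih e, ← hp (g * n + e)]
      congr 1
      ring
  induction g with
  | zero => simp
  | succ g ih =>
    rw [Nat.succ_mul, sum_range_add, ih]
    simp only [hp']
    push_cast
    ring

lemma sum_fractQuad_of_isCoprime (n : ℕ) (hn : 0 < n) (k : ℤ) (hk : IsCoprime k (n : ℤ)) :
    ∑ e ∈ range n, fractQuad (e * k / n) = ∑ e ∈ range n, ((e / n : ℚ) ^ 2 - e / n) := by
  have hn' : (n : ℤ) ≠ 0 := by positivity
  set f : ℕ → ℕ := fun e => ((e * k) % n).toNat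
  have hfc : ∀ e, (f e : ℤ) = (e * k) % n := fun e => Int.toNat_of_nonneg (Int.emod_nonneg _ hn')
  have hlt : ∀ e, f e < n := fun e => by
    have := Int.emod_lt_of_pos (e * k) (by exact_mod_cast hn : (0 : ℤ) < n)
    rw [← hfc] at this
    exact_mod_cast this
  have hinj : Set.InjOn f (range n) := by
    intro a ha b hb hab
    have h1 : (a * k : ℤ) % n = (b * k) % n := by rw [← hfc, ← hfc, hab]
    have h2 : (n : ℤ) ∣ (a - b) * k := by
      have := Int.ModEq.dvd (show (b * k : ℤ) ≡ a * k [ZMOD n] from h1.symm)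
      rwa [← sub_mul] at this
    have h3 := hk.symm.dvd_of_dvd_mul_right h2
    have ha' : a < n := by simpa using ha
    have hb' : b < n := by simpa using hb
    have := Int.eq_zero_of_abs_lt_dvd h3 (by rw [abs_lt]; omega)
    omega
  have himg : (range n).image f = range n := by
    apply eq_of_subset_of_card_le
    · intro x hx
      obtain ⟨e, -, rfl⟩ := mem_image.mp hx
      exact mem_range.mpr (hlt e)
    · rw [card_image_of_injOn hinj]
  conv_rhs => rw [← himg, sum_image hinj]
  refine sum_congr rfl fun e _ => ?_
  have h4 : (e * k / n : ℚ) = (f e / n : ℚ) + ((e * k / n : ℤ) : ℤ) := by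
    have h5 : (e * k : ℤ) = f e + n * (e * k / n) := by
      rw [hfc]; exact (Int.emod_add_mul_ediv _ _).symm
    have h6 : (e * k : ℚ) = f e + n * ((e * k / n : ℤ) : ℚ) := by exact_mod_cast h5
    field_simp
    linarith
  rw [h4, fractQuad_add_intCast, fractQuad_of_mem_Ico (by positivity)]
  rw [div_lt_one (by positivity)]
  exact_mod_cast hlt e

lemma sum_range_sq_sub_self (n N : ℕ) :
    ∑ e ∈ range N, ((e / n : ℚ) ^ 2 - e / n)
      = (N : ℚ) * (N - 1) * (2 * N - 1) / (6 * n ^ 2) - N * (N - 1) / (2 * n) := by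
  rcases eq_or_ne n 0 with rfl | hn
  · simp
  have hnq : (n : ℚ) ≠ 0 := by exact_mod_cast hn
  induction N with
  | zero => simp
  | succ N ih =>
    rw [sum_range_succ, ih]
    push_cast
    field_simp
    ring

lemma sum_fractQuad (d : ℕ) (hd : 0 < d) (k : ℤ) :
    ∑ e ∈ range d, fractQuad (e * k / d) = (Int.gcd k d : ℚ) ^ 2 / (6 * d) - d / 6 := by
  have hg : 0 < Int.gcd k d := Int.gcd_pos_of_ne_zero_right _ (by positivity)
  obtain ⟨k', n', hcop, hk, hn⟩ := Int.exists_gcd_one hg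
  generalize Int.gcd k d = g at *
  obtain ⟨n, rfl⟩ : ∃ n : ℕ, n' = n := Int.eq_ofNat_of_zero_le (by
    by_contra! h
    have : (n' * g : ℤ) < 0 := mul_neg_of_neg_of_pos h (by exact_mod_cast hg)
    omega)
  have hdn : d = g * n := by rw [mul_comm]; exact_mod_cast hn
  subst hdn
  have hn0 : 0 < n := Nat.pos_of_mul_pos_left hd
  have hgq : (g : ℚ) ≠ 0 := by positivity
  have hnq : (n : ℚ) ≠ 0 := by positivity
  have h1 : ∀ e : ℕ, (e * k / (g * n : ℕ) : ℚ) = e * k' / n := by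
    intro e
    rw [hk]
    push_cast
    field_simp
  simp only [h1]
  rw [sum_range_mul_of_periodic (fun e : ℕ => fractQuad (e * k' / n)) n,
    sum_fractQuad_of_isCoprime n hn0 k' (Int.isCoprime_iff_gcd_eq_one.mpr hcop),
    sum_range_sq_sub_self]
  · push_cast
    field_simp
    ring
  · intro e
    rw [← fractQuad_add_intCast (e * k' / n) k']
    congr 1
    push_cast
    field_simp

lemma sum_powerset_univ_fin_four {M : Type*} [AddCommMonoid M] (f : Finset (Fin 4) → M) :
    ∑ I ∈ (univ : Finset (Fin 4)).powerset, f I =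
      f ∅ + f {0} + f {1} + f {2} + f {3} + f {0, 1} + f {0, 2} + f {0, 3} + f {1, 2} + f {1, 3}
        + f {2, 3} + f {0, 1, 2} + f {0, 1, 3} + f {0, 2, 3} + f {1, 2, 3} + f {0, 1, 2, 3} := by
  have h : (univ : Finset (Fin 4)).powerset =
      {∅, {0}, {1}, {2}, {3}, {0, 1}, {0, 2}, {0, 3}, {1, 2}, {1, 3}, {2, 3}, {0, 1, 2},
        {0, 1, 3}, {0, 2, 3}, {1, 2, 3}, {0, 1, 2, 3}} := by decide
  rw [h]
  repeat rw [sum_insert (by decide)]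
  rw [sum_singleton]
  simp only [add_assoc]

lemma fractQuad_sum_add_intCast {ι : Type*} (I : Finset ι) (x : ι → ℚ) (z : ι → ℤ) :
    fractQuad (∑ i ∈ I, (x i + z i)) = fractQuad (∑ i ∈ I, x i) := by
  rw [sum_add_distrib, ← Int.cast_sum, fractQuad_add_intCast]

lemma fractQuad_add_eq_ite {u v : ℚ} (hu0 : 0 ≤ u) (hv0 : 0 ≤ v) (hu1 : u < 1) (hv1 : v < 1) :
    fractQuad (u + v) =
      if u + v < 1 then (u + v) ^ 2 - (u + v) else (u + v - 1) ^ 2 - (u + v - 1) := by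
  split_ifs with h
  · exact fractQuad_of_mem_Ico (add_nonneg hu0 hv0) h
  · exact fractQuad_of_one_le (not_lt.mp h) (by linarith)

lemma alternating_sum_fractQuad (x : Fin 4 → ℚ) (h0 : ∀ i, 0 ≤ x i) (h1 : ∀ i, x i < 1)
    (s : ℤ) (hs : ∑ i, x i = s) :
    ∑ I ∈ (univ : Finset (Fin 4)).powerset, (-1 : ℚ) ^ I.card * fractQuad (∑ i ∈ I, x i) =
      4 * if ∑ i, x i = 2 then
        if min (min (x 0) (x 1)) (min (x 2) (x 3)) + max (max (x 0) (x 1)) (max (x 2) (x 3)) ≤ 1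
        then min (min (x 0) (x 1)) (min (x 2) (x 3))
        else 1 - max (max (x 0) (x 1)) (max (x 2) (x 3))
      else 0 := by
  simp only [Fin.sum_univ_four] at hs ⊢
  have a0 := h0 0
  have a1 := h0 1
  have a2 := h0 2
  have a3 := h0 3
  have b0 := h1 0
  have b1 := h1 1
  have b2 := h1 2
  have b3 := h1 3
  have single : ∀ i, fractQuad (x i) = x i ^ 2 - x i := fun i => fractQuad_of_mem_Ico (h0 i) (h1 i)
  have zero : fractQuad 0 = 0 := by simp [fractQuad]
  have e0123 : fractQuad (x 0 + x 1 + x 2 + x 3) = 0 := by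
    rw [← zero]; exact fractQuad_eq_of_add_eq (n := s) (by linarith)
  have e012 : fractQuad (x 0 + x 1 + x 2) = fractQuad (x 3) := fractQuad_eq_of_add_eq (n := s) hs
  have e013 : fractQuad (x 0 + x 1 + x 3) = fractQuad (x 2) :=
    fractQuad_eq_of_add_eq (n := s) (by linarith)
  have e023 : fractQuad (x 0 + x 2 + x 3) = fractQuad (x 1) :=
    fractQuad_eq_of_add_eq (n := s) (by linarith)
  have e123 : fractQuad (x 1 + x 2 + x 3) = fractQuad (x 0) :=
    fractQuad_eq_of_add_eq (n := s) (by linarith)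
  have e12 : fractQuad (x 1 + x 2) = fractQuad (x 0 + x 3) :=
    fractQuad_eq_of_add_eq (n := s) (by linarith)
  have e13 : fractQuad (x 1 + x 3) = fractQuad (x 0 + x 2) :=
    fractQuad_eq_of_add_eq (n := s) (by linarith)
  have e23 : fractQuad (x 2 + x 3) = fractQuad (x 0 + x 1) :=
    fractQuad_eq_of_add_eq (n := s) (by linarith)
  have expand : ∑ I ∈ (univ : Finset (Fin 4)).powerset,
      (-1 : ℚ) ^ I.card * fractQuad (∑ i ∈ I, x i) =
      2 * (fractQuad (x 0 + x 1) + fractQuad (x 0 + x 2) + fractQuad (x 0 + x 3)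
        - fractQuad (x 0) - fractQuad (x 1) - fractQuad (x 2) - fractQuad (x 3)) := by
    rw [sum_powerset_univ_fin_four]
    simp [← add_assoc, zero, e0123, e012, e013, e023, e123, e12, e13, e23]
    ring
  rw [expand]
  rw [fractQuad_add_eq_ite a0 a1 b0 b1, fractQuad_add_eq_ite a0 a2 b0 b2,
    fractQuad_add_eq_ite a0 a3 b0 b3, single, single, single, single]
  have pair_le : ∀ u v : ℚ, u + v ≤ 1 →
      (if u + v < 1 then (u + v) ^ 2 - (u + v) else (u + v - 1) ^ 2 - (u + v - 1)) =
        (u + v) ^ 2 - (u + v) := by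
    intro u v h
    split_ifs with h'
    · rfl
    · rw [le_antisymm h (not_lt.mp h')]; norm_num
  have pair_ge : ∀ u v : ℚ, 1 ≤ u + v →
      (if u + v < 1 then (u + v) ^ 2 - (u + v) else (u + v - 1) ^ 2 - (u + v - 1)) =
        (u + v - 1) ^ 2 - (u + v - 1) := fun u v h => if_neg (not_lt.mpr h)
  have hs0 : 0 ≤ s := by
    have : (0 : ℚ) ≤ s := by linarith
    exact_mod_cast this
  have hs4 : s < 4 := by
    have : (s : ℚ) < 4 := by linarith
    exact_mod_cast this
  clear single zero e0123 e012 e013 e023 e123 e12 e13 e23 expand h0 h1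
  generalize x 0 = p at *
  generalize x 1 = q at *
  generalize x 2 = r at *
  generalize x 3 = t at *
  rw [hs]
  obtain rfl : t = s - p - q - r := by linarith
  clear hs
  interval_cases s
  · norm_num at a0 a1 a2 a3
    obtain rfl : p = 0 := by linarith
    obtain rfl : q = 0 := by linarith
    obtain rfl : r = 0 := by linarith
    norm_num
  · norm_num at b0 b1 b2 b3 a0 a1 a2 a3 ⊢
    rw [pair_le p q (by linarith), pair_le p r (by linarith), pair_le p _ (by linarith)]
    ring
  · clear pair_le pair_ge
    norm_num at *
    grind
  · norm_num at b0 b1 b2 b3 a0 a1 a2 a3 ⊢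
    rw [pair_ge p q (by linarith), pair_ge p r (by linarith), pair_ge p _ (by linarith)]
    ring

lemma F_eq_alternating_sum_fractQuad (d e : ℤ) (hd : 1 ≤ d) (m : Fin 4 → ℤ)
    (hsum : d ∣ ∑ i, m i) :
    F d e m = 1 / (4 * d) * ∑ I ∈ (univ : Finset (Fin 4)).powerset,
      (-1 : ℚ) ^ I.card * fractQuad (e * (∑ i ∈ I, m i : ℤ) / d) := by
  have hdq : (d : ℚ) ≠ 0 := by exact_mod_cast (by omega : d ≠ 0)
  have reduce : ∀ I : Finset (Fin 4),
      fractQuad (e * (∑ i ∈ I, m i : ℤ) / d) = fractQuad (∑ i ∈ I, age d e (m i)) := by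
    intro I
    rw [← fractQuad_sum_add_intCast I _ fun i => ⌊(e * m i : ℚ) / d⌋]
    simp only [age, Int.fract_add_floor]
    rw [Int.cast_sum, mul_sum, sum_div]
  obtain ⟨c, hc⟩ := hsum
  have hs : ∑ i, age d e (m i) = (e * c - ∑ i, ⌊(e * m i : ℚ) / d⌋ : ℤ) := by
    have hc' : (∑ i, m i : ℚ) = d * c := by exact_mod_cast hc
    simp only [age, Int.fract, sum_sub_distrib]
    rw [← sum_div, ← mul_sum, hc']
    push_cast
    field_simp
  simp only [reduce]
  rw [alternating_sum_fractQuad (fun i => age d e (m i)) (fun i => Int.fract_nonneg _)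
    (fun i => Int.fract_lt_one _) _ hs]
  unfold F sigmaE alphaE phiE
  split_ifs <;> (field_simp; try simp)

lemma sum_Icc_intCast_eq_sum_range (d : ℕ) (hd : 0 < d) (f : ℤ → ℚ) (h0 : f 0 = 0) :
    ∑ e ∈ Icc (1 : ℤ) (d - 1), f e = ∑ e ∈ range d, f e := by
  obtain ⟨n, rfl⟩ := Nat.exists_eq_succ_of_ne_zero hd.ne'
  rw [sum_range_succ']
  simp only [Nat.cast_zero, h0, add_zero]
  symm
  refine sum_nbij (fun e : ℕ => ((e + 1 : ℕ) : ℤ)) ?_ ?_ ?_ fun _ _ => rfl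
  · intro a ha
    simp only [mem_range] at ha
    simp only [mem_Icc]
    omega
  · intro a _ b _ hab
    simpa using hab
  · intro b hb
    simp only [coe_Icc, Set.mem_Icc] at hb
    exact ⟨(b - 1).toNat, by simp only [coe_range, Set.mem_Iio]; omega, by dsimp only; omega⟩

theorem sum_of_orbifold_degrees_eq_gcd_formula
    (d : ℤ) (hd : 1 ≤ d) (m : Fin 4 → ℤ)
    (hm0 : ∀ i, 0 ≤ m i) (hm1 : ∀ i, m i < d)
    (hsum : d ∣ ∑ i, m i)
    (hgcd : Int.gcd (m 0) (Int.gcd (m 1) (Int.gcd (m 2) (Int.gcd (m 3) d))) = 1) :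
    ∑ e ∈ Finset.Icc (1 : ℤ) (d - 1), F d e m
      = (1 / (24 * (d : ℚ) ^ 2)) *
          ∑ I ∈ (Finset.univ : Finset (Fin 4)).powerset,
            (-1 : ℚ) ^ I.card * (Int.gcd (∑ i ∈ I, m i) d : ℚ) ^ 2 := by
  lift d to ℕ using by omega
  have hd' : 0 < d := by omega
  have hdq : (d : ℚ) ≠ 0 := by positivity
  have cardSum : ∑ I ∈ (univ : Finset (Fin 4)).powerset, (-1 : ℚ) ^ I.card = 0 := by
    rw [sum_powerset_univ_fin_four]
    simp
    norm_num
  rw [sum_Icc_intCast_eq_sum_range d hd' (fun e => F d e m)]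
  · simp only [F_eq_alternating_sum_fractQuad (d : ℤ) _ hd m hsum]
    rw [← mul_sum, sum_comm]
    simp only [← mul_sum, Int.cast_natCast, sum_fractQuad d hd', mul_sub, sum_sub_distrib]
    rw [← sum_mul, cardSum, zero_mul, mul_zero, sub_zero, mul_sum, mul_sum]
    refine sum_congr rfl fun I _ => ?_
    field_simp
    norm_num
  · simp [F, sigmaE, age]
end

section
/- Let (d; m_1, m_2, m_3, m_4) be a 4-point monodromy datum and e an integer with 1 ≤ e ≤ d−1. Then the compact formula of Theorem 1.1 agrees with the casewise formula: if α_e + φ_e ≤ 1 then min{ α_e/d , σ_e − 1 } = F(e), and if α_e + φ_e > 1 then min{ (1 − φ_e)/d , 3 − σ_e } = F(e), where F(e) = α_e/d if σ_e = 2 and α_e + φ_e ≤ 1, F(e) = (1 − φ_e)/d if σ_e = 2 and α_e + φ_e > 1, and F(e) = 0 otherwise. -/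
open Finset

theorem dvd_mul_gcd {d e a b : ℤ} (ha : d ∣ e * a) (hb : d ∣ e * b) :
    d ∣ e * (Int.gcd a b : ℤ) := by
  rw [Int.gcd_eq_gcd_ab, mul_add, ← mul_assoc, ← mul_assoc]
  exact dvd_add (ha.mul_right _) (hb.mul_right _)

theorem age_nonneg (d e k : ℤ) : 0 ≤ age d e k := Int.fract_nonneg _

theorem age_lt_one (d e k : ℤ) : age d e k < 1 := Int.fract_lt_one _

theorem dvd_of_age_eq_zero {d e k : ℤ} (hd : d ≠ 0) (h : age d e k = 0) : d ∣ e * k := by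
  obtain ⟨z, hz⟩ := Int.fract_eq_zero_iff.mp h
  refine ⟨z, ?_⟩
  have hd' : (d : ℚ) ≠ 0 := by exact_mod_cast hd
  rw [eq_div_iff hd'] at hz
  have : z * d = e * k := by exact_mod_cast hz
  rw [← this, mul_comm]

theorem exists_int_eq_sigmaE {d : ℤ} (hd : d ≠ 0) (e : ℤ) {m : Fin 4 → ℤ}
    (hsum : d ∣ ∑ i, m i) : ∃ n : ℤ, sigmaE d e m = n := by
  obtain ⟨k, hk⟩ := hsum
  have hd' : (d : ℚ) ≠ 0 := by exact_mod_cast hd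
  refine ⟨e * k - ∑ i, ⌊(e * m i : ℚ) / d⌋, ?_⟩
  have hk' : ∑ i, (m i : ℚ) = d * k := by exact_mod_cast hk
  simp only [sigmaE, age, Int.fract, Finset.sum_sub_distrib, ← Finset.sum_div, ← Finset.mul_sum,
    hk']
  push_cast
  field_simp

theorem sigmaE_ne_zero {d e : ℤ} {m : Fin 4 → ℤ}
    (hgcd : Int.gcd (m 0) (Int.gcd (m 1) (Int.gcd (m 2) (Int.gcd (m 3) d))) = 1)
    (he : 1 ≤ e) (he' : e ≤ d - 1) : sigmaE d e m ≠ 0 := by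
  intro h
  have hz := (Finset.sum_eq_zero_iff_of_nonneg fun i _ => age_nonneg d e (m i)).mp h
  have hdvd (i : Fin 4) : d ∣ e * m i := dvd_of_age_eq_zero (by omega) (hz i (mem_univ i))
  have hde := dvd_mul_gcd (hdvd 0) (dvd_mul_gcd (hdvd 1) (dvd_mul_gcd (hdvd 2)
    (dvd_mul_gcd (hdvd 3) (dvd_mul_left d e))))
  rw [hgcd, Nat.cast_one, mul_one] at hde
  have := Int.le_of_dvd (by omega) hde
  omega

theorem alphaE_nonneg (d e : ℤ) (m : Fin 4 → ℤ) : 0 ≤ alphaE d e m := by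
  simp [alphaE, age_nonneg]

theorem phiE_lt_one (d e : ℤ) (m : Fin 4 → ℤ) : phiE d e m < 1 := by
  simp [phiE, age_lt_one]

theorem alphaE_le_phiE (d e : ℤ) (m : Fin 4 → ℤ) : alphaE d e m ≤ phiE d e m := by
  simp [alphaE, phiE]

theorem alphaE_add_phiE_bounds (d e : ℤ) (m : Fin 4 → ℤ) :
    alphaE d e m + phiE d e m ≤ sigmaE d e m ∧
      sigmaE d e m < alphaE d e m + phiE d e m + 2 := by
  have h0 (i : Fin 4) := age_nonneg d e (m i)
  have h1 (i : Fin 4) := age_lt_one d e (m i)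
  have := h0 0; have := h0 1; have := h0 2; have := h0 3
  have := h1 0; have := h1 1; have := h1 2; have := h1 3
  simp only [sigmaE, alphaE, phiE, Fin.sum_univ_four]
  grind

theorem compact_formula_agrees_with_casewise_formula
    (d : ℤ) (hd : 1 ≤ d) (m : Fin 4 → ℤ)
    (hm0 : ∀ i, 0 ≤ m i) (hm1 : ∀ i, m i < d)
    (hsum : d ∣ ∑ i, m i)
    (hgcd : Int.gcd (m 0) (Int.gcd (m 1) (Int.gcd (m 2) (Int.gcd (m 3) d))) = 1)
    (e : ℤ) (he : 1 ≤ e) (he' : e ≤ d - 1) :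
    (alphaE d e m + phiE d e m ≤ 1 →
      min (alphaE d e m / (d : ℚ)) (sigmaE d e m - 1) = F d e m) ∧
    (1 < alphaE d e m + phiE d e m →
      min ((1 - phiE d e m) / (d : ℚ)) (3 - sigmaE d e m) = F d e m) := by
  have hd0 : d ≠ 0 := by omega
  have hdq : (1 : ℚ) ≤ d := by exact_mod_cast hd
  have hα := alphaE_nonneg d e m
  have hφ := phiE_lt_one d e m
  have hαφ := alphaE_le_phiE d e m
  obtain ⟨hlo, hhi⟩ := alphaE_add_phiE_bounds d e m
  have hne := sigmaE_ne_zero hgcd he he'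
  obtain ⟨n, hn⟩ := exists_int_eq_sigmaE hd0 e hsum
  rw [hn] at hlo hhi hne
  have hn0 : 0 < n := by
    have : (0 : ℚ) ≤ n := by linarith
    have : 0 ≤ n := by exact_mod_cast this
    have : n ≠ 0 := by exact_mod_cast hne
    omega
  have hn4 : n < 4 := by
    have : (n : ℚ) < 4 := by linarith
    exact_mod_cast this
  have hαd : 0 ≤ alphaE d e m / d := div_nonneg hα (by linarith)
  have hαd' : alphaE d e m / d ≤ 1 := div_le_one_of_le₀ (by linarith) (by linarith)
  have hφd : 0 ≤ (1 - phiE d e m) / d := div_nonneg (by linarith) (by linarith)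
  have hφd' : (1 - phiE d e m) / d ≤ 1 := div_le_one_of_le₀ (by linarith) (by linarith)
  unfold F
  rw [hn]
  constructor <;> intro h <;> interval_cases n <;> norm_num at * <;> grind
end

section
/- Let (d; m_1, m_2, m_3, m_4) be a 4-point monodromy datum and e an integer with 1 ≤ e ≤ d−1. Then F(e) = (1/(2d)) · Σ_{I ⊆ {1,2,3,4}} (−1)^{|I|} · min{ 0 , 1 − Σ_{i∈I} ⟨e m_i/d⟩ }, where F(e) = α_e/d if σ_e = 2 and α_e + φ_e ≤ 1, F(e) = (1 − φ_e)/d if σ_e = 2 and α_e + φ_e > 1, and F(e) = 0 otherwise. (This is the degree identity asserted by the paper's graph formula for λ_1^e in the 4-pointed case.) -/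
open Finset

/-- The alternating sum of `g` over the subset sums of four numbers, written out. -/
theorem sum_powerset_fin_four (x : Fin 4 → ℚ) (g : ℚ → ℚ) :
    ∑ I ∈ (univ : Finset (Fin 4)).powerset, (-1 : ℚ) ^ I.card * g (∑ i ∈ I, x i)
      = g 0 - (g (x 0) + g (x 1) + g (x 2) + g (x 3))
        + (g (x 0 + x 1) + g (x 2 + x 3)) + (g (x 0 + x 2) + g (x 1 + x 3))
        + (g (x 0 + x 3) + g (x 1 + x 2))
        - (g (x 1 + x 2 + x 3) + g (x 0 + x 2 + x 3) + g (x 0 + x 1 + x 3)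
          + g (x 0 + x 1 + x 2))
        + g (x 0 + x 1 + x 2 + x 3) := by
  have h : (univ : Finset (Fin 4)).powerset =
      {∅, {0}, {1}, {2}, {3}, {0, 1}, {2, 3}, {0, 2}, {1, 3}, {0, 3}, {1, 2},
        {1, 2, 3}, {0, 2, 3}, {0, 1, 3}, {0, 1, 2}, {0, 1, 2, 3}} := by decide
  rw [h]
  repeat rw [sum_insert (by decide)]
  simp [← add_assoc]
  ring

/-- In the case of total `2`, complementary pairs contribute `-|1 - s|`. -/
theorem min_pair_of_add_eq_two {s t : ℚ} (h : s + t = 2) :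
    min 0 (1 - s) + min 0 (1 - t) = -|1 - s| := by
  rcases le_total s 1 with hs | hs
  · rw [min_eq_left (by linarith), min_eq_right (by linarith), abs_of_nonneg (by linarith)]
    linarith
  · rw [min_eq_right (by linarith), min_eq_left (by linarith), abs_of_nonpos (by linarith)]
    linarith

/-- The extreme values of four numbers with sum `2`, via the pairings. -/
theorem one_sub_abs_pairs_of_sum_eq_two {a b c d : ℚ} (h : a + b + c + d = 2) :
    1 - |1 - (a + b)| - |1 - (a + c)| - |1 - (a + d)| =
      2 * if min (min a b) (min c d) + max (max a b) (max c d) ≤ 1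
        then min (min a b) (min c d) else 1 - max (max a b) (max c d) := by
  obtain rfl : d = 2 - a - b - c := by linarith
  rcases le_total a b with h1 | h1 <;>
  rcases le_total c (2 - a - b - c) with h2 | h2 <;>
  simp only [h1, h2, min_eq_left, min_eq_right, max_eq_left, max_eq_right] <;>
  grind

theorem graph_formula_for_orbifold_lambda_one
    (d : ℤ) (hd : 1 ≤ d) (m : Fin 4 → ℤ)
    (hm0 : ∀ i, 0 ≤ m i) (hm1 : ∀ i, m i < d)
    (hsum : d ∣ ∑ i, m i)
    (hgcd : Int.gcd (m 0) (Int.gcd (m 1) (Int.gcd (m 2) (Int.gcd (m 3) d))) = 1)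
    (e : ℤ) (he : 1 ≤ e) (he' : e ≤ d - 1) :
    F d e m
      = (1 / (2 * (d : ℚ))) *
          ∑ I ∈ (Finset.univ : Finset (Fin 4)).powerset,
            (-1 : ℚ) ^ I.card * min 0 (1 - ∑ i ∈ I, age d e (m i)) := by
  have h0 : ∀ i, 0 ≤ age d e (m i) := fun i => Int.fract_nonneg _
  have h1 : ∀ i, age d e (m i) < 1 := fun i => Int.fract_lt_one _
  have hd0 : (d : ℚ) ≠ 0 := by exact_mod_cast (by omega : d ≠ 0)
  obtain ⟨n, hn⟩ : ∃ n : ℤ, sigmaE d e m = n := by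
    obtain ⟨k, hk⟩ := hsum
    refine ⟨e * k - ∑ i, ⌊((e * m i : ℚ) / (d : ℚ))⌋, ?_⟩
    have hk' : ∑ i, (m i : ℚ) = d * k := by exact_mod_cast hk
    simp only [sigmaE, age, Int.fract, sum_sub_distrib, ← sum_div, ← mul_sum, hk']
    push_cast
    field_simp
  rw [sum_powerset_fin_four (fun i => age d e (m i)) (fun s => min 0 (1 - s))]
  unfold F alphaE phiE
  have hs : sigmaE d e m = age d e (m 0) + age d e (m 1) + age d e (m 2) + age d e (m 3) :=
    Fin.sum_univ_four _
  have a0 := h0 0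
  have b0 := h0 1
  have c0 := h0 2
  have d0 := h0 3
  have a1 := h1 0
  have b1 := h1 1
  have c1 := h1 2
  have d1 := h1 3
  generalize age d e (m 0) = a at *
  generalize age d e (m 1) = b at *
  generalize age d e (m 2) = c at *
  generalize age d e (m 3) = f at *
  rw [hs] at hn ⊢
  have hn4 : n < 4 := by
    have : (n : ℚ) < 4 := by linarith
    exact_mod_cast this
  have z0 : min 0 (1 - (0 : ℚ)) = 0 := min_eq_left (by norm_num)
  have za : min 0 (1 - a) = 0 := min_eq_left (by linarith)
  have zb : min 0 (1 - b) = 0 := min_eq_left (by linarith)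
  have zc : min 0 (1 - c) = 0 := min_eq_left (by linarith)
  have zf : min 0 (1 - f) = 0 := min_eq_left (by linarith)
  simp only [z0, za, zb, zc, zf]
  rcases (by omega : n ≤ 1 ∨ n = 2 ∨ n = 3) with hn | rfl | rfl
  · have hle : a + b + c + f ≤ 1 := by
      rw [‹a + b + c + f = n›]
      exact_mod_cast hn
    rw [if_neg (by linarith)]
    repeat rw [min_eq_left (by linarith)]
    simp
  · push_cast at hn
    rw [if_pos hn, min_pair_of_add_eq_two (by linarith), min_pair_of_add_eq_two (by linarith),
      min_pair_of_add_eq_two (by linarith)]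
    repeat rw [min_eq_right (b := 1 - (_ + _ + _)) (by linarith)]
    have key := one_sub_abs_pairs_of_sum_eq_two hn
    rw [← ite_div]
    field_simp
    linarith
  · push_cast at hn
    rw [if_neg (by linarith)]
    repeat rw [min_eq_right (by linarith)]
    rw [eq_comm, mul_eq_zero]
    right
    linarith
end
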